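/- Let n ≥ 1 be an integer and let ∂V ⊆ V be nonempty. Then the dimension of the eigenspace N^{∂V}(n²π²) equals |E| − |V| + |∂V|. -/

import Mathlib

open Finset
open scoped Classical

variable {V E : Type*}

/-- The number of incidences of edges at the vertex `v` (a loop counts twice). -/
noncomputable def degE [Fintype E] [DecidableEq V] (s t : E → V) (v : V) : ℕ :=
  (univ.filter fun e => s e = v).card + (univ.filter fun e => t e = v).card

/-- The `λ`-eigenspace `N^{∂V}(λ)` of the Kirchhoff Laplacian of the equilateral
metric graph associated to `(V,E,s,t)` with Dirichlet conditions on `∂V`,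
modelled as the set of pairs `(f,F)` of edge functions solving `f'' = −λ f` and
vertex values, subject to continuity, Dirichlet and Kirchhoff conditions. -/
noncomputable def metricEigenspace [Fintype E] [DecidableEq V] (s t : E → V)
    (bd : Finset V) (lam : ℝ) : Set ((E → ℝ → ℂ) × (V → ℂ)) :=
  {p | (∀ e, ContDiff ℝ 2 (p.1 e)) ∧
    (∀ e x, deriv (deriv (p.1 e)) x = -(lam : ℂ) * p.1 e x) ∧
    (∀ e, p.1 e 0 = p.2 (s e)) ∧ (∀ e, p.1 e 1 = p.2 (t e)) ∧
    (∀ v ∈ bd, p.2 v = 0) ∧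
    (∀ v, v ∉ bd →
      (∑ e ∈ univ.filter fun e => s e = v, deriv (p.1 e) 0) =
        ∑ e ∈ univ.filter fun e => t e = v, deriv (p.1 e) 1)}

/-- The real cosine `x ↦ cos (k x)`, valued in `ℂ`, and its derivative. -/
lemma hasDerivAt_ofReal_cos_mul (k x : ℝ) :
    HasDerivAt (fun x : ℝ => ((Real.cos (k * x) : ℝ) : ℂ)) (-(k : ℂ) * (Real.sin (k * x) : ℝ)) x := by
  have h := (((hasDerivAt_id x).const_mul k).cos).ofReal_comp
  refine h.congr_deriv ?_
  simp only [id]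
  push_cast
  ring

/-- The real sine `x ↦ sin (k x)`, valued in `ℂ`, and its derivative. -/
lemma hasDerivAt_ofReal_sin_mul (k x : ℝ) :
    HasDerivAt (fun x : ℝ => ((Real.sin (k * x) : ℝ) : ℂ)) ((k : ℂ) * (Real.cos (k * x) : ℝ)) x := by
  have h := (((hasDerivAt_id x).const_mul k).sin).ofReal_comp
  refine h.congr_deriv ?_
  simp only [id]
  push_cast
  ring

/-- Every solution of `u'' = -k² u` is the expected combination of `cos (k x)` and `sin (k x)`. -/
lemma eq_cos_add_sin_of_deriv_deriv_eq {k : ℝ} (hk : k ≠ 0) {u : ℝ → ℂ} (hu : ContDiff ℝ 2 u)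
    (hode : ∀ x, deriv (deriv u) x = -((k ^ 2 : ℝ) : ℂ) * u x) (x : ℝ) :
    u x = u 0 * (Real.cos (k * x) : ℝ) + deriv u 0 / k * (Real.sin (k * x) : ℝ) := by
  have hkc : (k : ℂ) ≠ 0 := by exact_mod_cast hk
  have hu1 (x : ℝ) : HasDerivAt u (deriv u x) x :=
    (hu.differentiable (by norm_num) x).hasDerivAt
  have hd : ContDiff ℝ 1 (deriv u) := (contDiff_succ_iff_deriv.1 (one_add_one_eq_two (R := WithTop ℕ∞) ▸ hu)).2.2
  have hu2 (x : ℝ) : HasDerivAt (deriv u) (-((k ^ 2 : ℝ) : ℂ) * u x) x :=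
    hode x ▸ (hd.differentiable (by norm_num) x).hasDerivAt
  have hA (x : ℝ) : HasDerivAt (fun x : ℝ => u x * (Real.cos (k * x) : ℝ)
      - deriv u x / k * (Real.sin (k * x) : ℝ)) 0 x := by
    refine (((hu1 x).mul (hasDerivAt_ofReal_cos_mul k x)).sub
      (((hu2 x).div_const (k : ℂ)).mul (hasDerivAt_ofReal_sin_mul k x))).congr_deriv ?_
    push_cast
    field_simp
    ring
  have hB (x : ℝ) : HasDerivAt (fun x : ℝ => u x * (Real.sin (k * x) : ℝ)
      + deriv u x / k * (Real.cos (k * x) : ℝ)) 0 x := by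
    refine (((hu1 x).mul (hasDerivAt_ofReal_sin_mul k x)).add
      (((hu2 x).div_const (k : ℂ)).mul (hasDerivAt_ofReal_cos_mul k x))).congr_deriv ?_
    push_cast
    field_simp
    ring
  have hA0 := is_const_of_deriv_eq_zero (fun x => (hA x).differentiableAt)
    (fun x => (hA x).deriv) x 0
  have hB0 := is_const_of_deriv_eq_zero (fun x => (hB x).differentiableAt)
    (fun x => (hB x).deriv) x 0
  simp only [mul_zero, Real.cos_zero, Real.sin_zero, Complex.ofReal_one, Complex.ofReal_zero,
    mul_one, sub_zero, zero_add] at hA0 hB0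
  have hcs : ((Real.sin (k * x) : ℝ) : ℂ) ^ 2 + ((Real.cos (k * x) : ℝ) : ℂ) ^ 2 = 1 := by
    exact_mod_cast Real.sin_sq_add_cos_sq (k * x)
  rw [← hA0, ← hB0]
  linear_combination (-u x) * hcs

/-- On a connected graph, a vertex function whose zero set is transported along edges and which
vanishes somewhere is zero. -/
lemma eq_zero_of_eqvGen {V E : Type*} {s t : E → V}
    (hconn : ∀ v w : V, Relation.EqvGen (fun a b => ∃ e, s e = a ∧ t e = b) v w)
    {g : V → ℂ} (hg : ∀ e, g (s e) = 0 ↔ g (t e) = 0) {v₀ : V} (h₀ : g v₀ = 0) (v : V) :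
    g v = 0 := by
  have key : ∀ a b, Relation.EqvGen (fun a b => ∃ e, s e = a ∧ t e = b) a b →
      (g a = 0 ↔ g b = 0) := by
    intro a b h
    induction h with
    | rel a b h => obtain ⟨e, rfl, rfl⟩ := h; exact hg e
    | refl a => rfl
    | symm a b _ ih => exact ih.symm
    | trans a b c _ _ ih₁ ih₂ => exact ih₁.trans ih₂
  exact (key v₀ v (hconn v₀ v)).1 h₀

/-- The Kirchhoff defect at the interior vertices of the edge functions `b e * sin (k x)`, up to
the factor `k`; here `c = cos k`. -/
noncomputable def kirchhoffMap [Fintype E] [DecidableEq V] (s t : E → V) (bd : Finset V) (c : ℂ) :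
    (E → ℂ) →ₗ[ℂ] ({v // v ∉ bd} → ℂ) where
  toFun b v := (∑ e ∈ univ.filter fun e => s e = v.1, b e)
    - c * ∑ e ∈ univ.filter fun e => t e = v.1, b e
  map_add' b b' := by
    funext v
    simp only [Pi.add_apply, sum_add_distrib]
    ring
  map_smul' a b := by
    funext v
    simp only [Pi.smul_apply, smul_eq_mul, ← mul_sum, RingHom.id_apply]
    ring

lemma kirchhoffMap_surjective [Fintype V] [Fintype E] [DecidableEq V] {s t : E → V}
    (hconn : ∀ v w : V, Relation.EqvGen (fun a b => ∃ e, s e = a ∧ t e = b) v w)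
    {bd : Finset V} (hbd : bd.Nonempty) {c : ℂ} (hc : c ≠ 0) :
    Function.Surjective (kirchhoffMap s t bd c) := by
  rw [← LinearMap.range_eq_top]
  by_contra hne
  obtain ⟨f, hf, hle⟩ := Submodule.exists_le_ker_of_lt_top _ (lt_top_iff_ne_top.2 hne)
  let δ : V → {v // v ∉ bd} → ℂ := fun v w => if v = w.1 then 1 else 0
  have hδ (e : E) : kirchhoffMap s t bd c (Pi.single e 1) = δ (s e) - c • δ (t e) := by
    funext v
    simp [kirchhoffMap, δ, sum_pi_single']
  have hst (e : E) : f (δ (s e)) = c * f (δ (t e)) := by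
    have h : f (kirchhoffMap s t bd c (Pi.single e 1)) = 0 := hle (LinearMap.mem_range_self _ _)
    rw [hδ, map_sub, map_smul, smul_eq_mul, sub_eq_zero] at h
    exact h
  obtain ⟨v₀, hv₀⟩ := hbd
  have h₀ : δ v₀ = 0 := by
    funext w
    exact if_neg fun h : v₀ = w.1 => w.2 (h ▸ hv₀)
  have hzero := eq_zero_of_eqvGen (g := fun v => f (δ v)) hconn
    (fun e => by simp [hst e, hc]) (v₀ := v₀) (by simp [h₀])
  refine hf (LinearMap.pi_ext' fun v => LinearMap.ext_ring ?_)
  have hs : Pi.single v (1 : ℂ) = δ v.1 := by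
    funext w
    simp [δ, Pi.single_apply, Subtype.ext_iff, eq_comm]
  simpa [hs] using hzero v.1

/-- The map sending coefficients `b` to the edge functions `b e * sin (k x)` with zero vertex
values. -/
noncomputable def sineMap (V E : Type*) (k : ℝ) : (E → ℂ) →ₗ[ℂ] (E → ℝ → ℂ) × (V → ℂ) where
  toFun b := (fun e x => b e * (Real.sin (k * x) : ℝ), 0)
  map_add' b b' := by
    ext <;> simp [add_mul]
  map_smul' a b := by
    ext <;> simp [mul_assoc]

lemma sineMap_injective {k : ℝ} (hk : k ≠ 0) : Function.Injective (sineMap V E k) := by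
  intro b b' h
  funext e
  have h1 := congrFun (congrFun (congrArg Prod.fst h) e) (Real.pi / 2 / k)
  have hx : k * (Real.pi / 2 / k) = Real.pi / 2 := by field_simp
  simpa only [sineMap, LinearMap.coe_mk, AddHom.coe_mk, hx, Real.sin_pi_div_two,
    Complex.ofReal_one, mul_one] using h1

lemma deriv_const_mul_sin (a : ℂ) (k : ℝ) :
    deriv (fun x : ℝ => a * ((Real.sin (k * x) : ℝ) : ℂ)) =
      fun x : ℝ => a * (k * (Real.cos (k * x) : ℝ)) :=
  funext fun x => ((hasDerivAt_ofReal_sin_mul k x).const_mul a).deriv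

lemma metricEigenspace_eq_map [Fintype E] [DecidableEq V] {s t : E → V}
    (hconn : ∀ v w : V, Relation.EqvGen (fun a b => ∃ e, s e = a ∧ t e = b) v w)
    {bd : Finset V} (hbd : bd.Nonempty) {k : ℝ} (hk : k ≠ 0) (hsin : Real.sin k = 0) :
    metricEigenspace s t bd (k ^ 2) =
      (LinearMap.ker (kirchhoffMap s t bd (Real.cos k : ℝ))).map (sineMap V E k) := by
  have hkc : (k : ℂ) ≠ 0 := by exact_mod_cast hk
  have hcos : ((Real.cos k : ℝ) : ℂ) ≠ 0 := by
    intro h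
    have h' : Real.cos k = 0 := by exact_mod_cast h
    simpa [hsin, h'] using Real.sin_sq_add_cos_sq k
  have hkirch (b : E → ℂ) : (∀ v, v ∉ bd →
      (∑ e ∈ univ.filter fun e => s e = v, deriv ((sineMap V E k b).1 e) 0) =
        ∑ e ∈ univ.filter fun e => t e = v, deriv ((sineMap V E k b).1 e) 1) ↔
      b ∈ LinearMap.ker (kirchhoffMap s t bd (Real.cos k : ℝ)) := by
    rw [LinearMap.mem_ker, funext_iff, Subtype.forall]
    refine forall₂_congr fun v _ => ?_
    simp only [sineMap, kirchhoffMap, LinearMap.coe_mk, AddHom.coe_mk, deriv_const_mul_sin,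
      mul_zero, Real.cos_zero, mul_one, Complex.ofReal_one, Pi.zero_apply, ← sum_mul]
    rw [sub_eq_zero, mul_comm (k : ℂ), ← mul_assoc, mul_left_inj' hkc, mul_comm]
  ext ⟨f, F⟩
  simp only [SetLike.mem_coe, Submodule.mem_map]
  constructor
  · rintro ⟨hf, hode, h0, h1, hF, hK⟩
    simp only at hf hode h0 h1 hF hK
    have hsol (e : E) := eq_cos_add_sin_of_deriv_deriv_eq hk (hf e) (hode e)
    obtain ⟨v₀, hv₀⟩ := hbd
    have hF0 : F = 0 := funext <| eq_zero_of_eqvGen hconn (fun e => by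
      rw [← h0, ← h1, hsol e 1]
      simp [hsin, hcos, -Complex.ofReal_cos]) (hF v₀ hv₀)
    have heq : sineMap V E k (fun e => deriv (f e) 0 / k) = (f, F) := by
      refine Prod.ext (funext₂ fun e x => ?_) hF0.symm
      change _ = f e x
      rw [hsol e x, h0, hF0]
      simp [sineMap]
    refine ⟨_, (hkirch _).1 ?_, heq⟩
    rw [heq]
    exact hK
  · rintro ⟨b, hb, hbeq⟩
    rw [← hbeq]
    refine ⟨fun e => ?_, fun e x => ?_, fun e => ?_, fun e => ?_, fun v _ => rfl, (hkirch b).2 hb⟩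
    · exact contDiff_const.mul (Complex.ofRealCLM.contDiff.comp
        (Real.contDiff_sin.comp (contDiff_const.mul contDiff_id)))
    · simp only [sineMap, LinearMap.coe_mk, AddHom.coe_mk, deriv_const_mul_sin]
      rw [(((hasDerivAt_ofReal_cos_mul k x).const_mul (k : ℂ)).const_mul (b e)).deriv]
      push_cast
      ring
    · simp [sineMap]
    · simp [sineMap, hsin, -Complex.ofReal_sin]


/-- **Multiplicity of the exceptional metric eigenvalues, `∂V ≠ ∅`.**
For a finite connected equilateral metric graph with nonempty Dirichlet
boundary `∂V`, `dim N^{∂V}(n²π²) = |E| − |V| + |∂V|`. -/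
theorem metric_eigenspace_dimension_with_boundary
    [Fintype V] [Fintype E] [DecidableEq V] [Nonempty V] [Nonempty E]
    (s t : E → V)
    (hconn : ∀ v w : V, Relation.EqvGen (fun a b => ∃ e, s e = a ∧ t e = b) v w)
    (hend : ∀ v : V, ∃ e : E, s e = v ∨ t e = v)
    (bd : Finset V) (hbd : bd.Nonempty)
    (n : ℕ) (hn : 1 ≤ n) :
    (Module.finrank ℂ (Submodule.span ℂ
        (metricEigenspace s t bd ((n : ℝ) ^ 2 * Real.pi ^ 2))) : ℤ) =
      (Fintype.card E : ℤ) - Fintype.card V + bd.card := by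
  have hk : (n : ℝ) * Real.pi ≠ 0 :=
    mul_ne_zero (by exact_mod_cast (by omega : n ≠ 0)) Real.pi_ne_zero
  have hsin := Real.sin_nat_mul_pi n
  have hcos : ((Real.cos (n * Real.pi) : ℝ) : ℂ) ≠ 0 := by
    simp [Real.cos_nat_mul_pi, -Complex.ofReal_cos]
  have hrank := LinearMap.finrank_range_add_finrank_ker
    (kirchhoffMap s t bd (Real.cos (n * Real.pi) : ℝ))
  rw [LinearMap.range_eq_top.2 (kirchhoffMap_surjective hconn hbd hcos), finrank_top,
    Module.finrank_fintype_fun_eq_card, Module.finrank_fintype_fun_eq_card,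
    Fintype.card_subtype_compl, Fintype.card_coe] at hrank
  rw [← mul_pow, metricEigenspace_eq_map hconn hbd hk hsin, Submodule.span_eq,
    ← (Submodule.equivMapOfInjective _ (sineMap_injective hk) _).finrank_eq]
  have := card_le_univ bd
  omega
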